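/- Let α > 0, let Y be a set, and let f : {0,1}^n → Y be a (deterministic) function such that every fiber of f has density at most α, i.e. |f⁻¹(y)|/2ⁿ ≤ α for all y ∈ Y. Then for every ρ ∈ [0,1], Pr[f(x̃) = f(x)] ≤ α^{(1/2)·(1−ρ²)/(1+ρ²)}, where x is uniform on {0,1}^n and x̃ ← N_ρ(x). -/

import Mathlib

/-- The probability that the noise channel `N_ρ` maps `x` to `y`: each bit of `x` is kept
with probability `(1+ρ)/2` and flipped with probability `(1-ρ)/2`. -/
noncomputable def noiseK (ρ : ℝ) {n : ℕ} (x y : Fin n → Bool) : ℝ :=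
  ∏ i, if y i = x i then (1 + ρ) / 2 else (1 - ρ) / 2

open Finset

lemma two_mul_le_rpow_one_add_sub_rpow_one_sub {r t : ℝ} (hr0 : 0 ≤ r) (hr1 : r ≤ 1)
    (ht0 : 0 ≤ t) (ht1 : t ≤ 1) :
    2 * r * t ≤ (1 + t) ^ r - (1 - t) ^ r := by
  have hmono : MonotoneOn (fun s : ℝ => (1 + s) ^ r - (1 - s) ^ r - 2 * r * s)
      (Set.Icc 0 1) := by
    refine monotoneOn_of_hasDerivWithinAt_nonneg
      (f' := fun s => r * ((1 + s) ^ (r - 1) + (1 - s) ^ (r - 1) - 2)) (convex_Icc 0 1) ?_ ?_ ?_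
    · refine ContinuousOn.sub (ContinuousOn.sub ?_ ?_) (by fun_prop)
      · exact ContinuousOn.rpow_const (by fun_prop) fun _ _ => Or.inr hr0
      · exact ContinuousOn.rpow_const (by fun_prop) fun _ _ => Or.inr hr0
    · intro s hs
      rw [interior_Icc] at hs
      have h1 := ((hasDerivAt_id s).const_add 1).rpow_const (p := r)
        (Or.inl (by simp only [id]; linarith [hs.1]))
      have h2 := ((hasDerivAt_id s).const_sub 1).rpow_const (p := r)
        (Or.inl (by simp only [id]; linarith [hs.2]))
      have h3 := (hasDerivAt_id s).const_mul (2 * r)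
      refine HasDerivAt.hasDerivWithinAt (((h1.sub h2).sub h3).congr_deriv ?_)
      simp only [id]
      ring
    · intro s hs
      rw [interior_Icc] at hs
      have ha : 0 < 1 + s := by linarith [hs.1]
      have hb : 0 < 1 - s := by linarith [hs.2]
      have hx := Real.rpow_pos_of_pos ha (r - 1)
      have hy := Real.rpow_pos_of_pos hb (r - 1)
      have hxy : 1 ≤ (1 + s) ^ (r - 1) * (1 - s) ^ (r - 1) := by
        rw [← Real.mul_rpow ha.le hb.le]
        exact Real.one_le_rpow_of_pos_of_le_one_of_nonpos (mul_pos ha hb)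
          (by nlinarith [hs.1]) (by linarith)
      refine mul_nonneg hr0 ?_
      nlinarith [sq_nonneg ((1 + s) ^ (r - 1) - (1 - s) ^ (r - 1))]
  have h := hmono (Set.left_mem_Icc.2 zero_le_one) ⟨ht0, ht1⟩ ht0
  norm_num at h
  linarith

lemma two_add_le_rpow_one_add_add_rpow_one_sub {r t : ℝ} (hr0 : 0 ≤ r) (hr1 : r ≤ 1)
    (ht0 : 0 ≤ t) (ht1 : t ≤ 1) :
    2 + (1 + r) * r * t ^ 2 ≤ (1 + t) ^ (1 + r) + (1 - t) ^ (1 + r) := by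
  have hmono : MonotoneOn (fun s : ℝ => (1 + s) ^ (1 + r) + (1 - s) ^ (1 + r)
      - (1 + r) * r * s ^ 2) (Set.Icc 0 1) := by
    refine monotoneOn_of_hasDerivWithinAt_nonneg
      (f' := fun s => (1 + r) * ((1 + s) ^ r - (1 - s) ^ r - 2 * r * s)) (convex_Icc 0 1) ?_ ?_ ?_
    · refine ContinuousOn.sub (ContinuousOn.add ?_ ?_) (by fun_prop)
      · exact ContinuousOn.rpow_const (by fun_prop) fun _ _ => Or.inr (by linarith)
      · exact ContinuousOn.rpow_const (by fun_prop) fun _ _ => Or.inr (by linarith)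
    · intro s _
      have h1 := ((hasDerivAt_id s).const_add 1).rpow_const (p := 1 + r) (Or.inr (by linarith))
      have h2 := ((hasDerivAt_id s).const_sub 1).rpow_const (p := 1 + r) (Or.inr (by linarith))
      have h3 := ((hasDerivAt_id s).pow 2).const_mul ((1 + r) * r)
      refine HasDerivAt.hasDerivWithinAt (((h1.add h2).sub h3).congr_deriv ?_)
      simp only [id, add_sub_cancel_left]
      push_cast
      ring
    · intro s hs
      rw [interior_Icc] at hs
      have := two_mul_le_rpow_one_add_sub_rpow_one_sub hr0 hr1 hs.1.le hs.2.le
      exact mul_nonneg (by linarith) (by linarith)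
  have h := hmono (Set.left_mem_Icc.2 zero_le_one) ⟨ht0, ht1⟩ ht0
  norm_num at h
  linarith

/-- The two-point hypercontractive inequality, from `L^(1+ρ)` to `L²` with noise `√ρ`. -/
lemma two_point_hypercontractive {ρ u v : ℝ} (h0 : 0 ≤ ρ) (h1 : ρ ≤ 1)
    (hu : 0 ≤ u) (hv : 0 ≤ v) :
    ((u + v) / 2) ^ 2 + ρ * ((u - v) / 2) ^ 2
      ≤ ((u ^ (1 + ρ) + v ^ (1 + ρ)) / 2) ^ (2 / (1 + ρ)) := by
  wlog huv : v ≤ u generalizing u v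
  · have := this hv hu (le_of_not_ge huv)
    rw [add_comm (u ^ _)]
    linarith
  rcases hu.eq_or_lt with rfl | hupos
  · obtain rfl : v = 0 := le_antisymm huv hv
    simpa using Real.rpow_nonneg (by positivity) _
  have hp : 0 < 1 + ρ := by linarith
  obtain ⟨m, y, hm, hy0, hy1, rfl, rfl⟩ : ∃ m y : ℝ, 0 < m ∧ 0 ≤ y ∧ y ≤ 1 ∧
      u = m * (1 + y) ∧ v = m * (1 - y) := by
    have hs : 0 < u + v := by linarith
    refine ⟨(u + v) / 2, (u - v) / (u + v), by linarith, div_nonneg (by linarith) hs.le,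
      (div_le_one hs).2 (by linarith), ?_, ?_⟩ <;> field_simp <;> ring
  have hz : 0 ≤ ρ * y ^ 2 := by positivity
  have hbern := rpow_one_add_le_one_add_mul_self (s := ρ * y ^ 2) (p := (1 + ρ) / 2)
    (by linarith) (by linarith) (by linarith)
  have hseries := two_add_le_rpow_one_add_add_rpow_one_sub h0 h1 hy0 hy1
  have hkey : (1 + ρ * y ^ 2) ^ ((1 + ρ) / 2)
      ≤ ((1 + y) ^ (1 + ρ) + (1 - y) ^ (1 + ρ)) / 2 := by linarith
  have hpow := Real.rpow_le_rpow (z := 2 / (1 + ρ)) (by positivity) hkey (by positivity)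
  rw [← Real.rpow_mul (by positivity), show (1 + ρ) / 2 * (2 / (1 + ρ)) = 1 by field_simp,
    Real.rpow_one] at hpow
  rw [Real.mul_rpow hm.le (by linarith), Real.mul_rpow hm.le (by linarith),
    ← mul_add (m ^ (1 + ρ)), mul_div_assoc (m ^ (1 + ρ)), Real.mul_rpow (by positivity)
      (by have := Real.rpow_nonneg (sub_nonneg.2 hy1) (1 + ρ); positivity),
    ← Real.rpow_mul hm.le, mul_div_cancel₀ _ hp.ne', Real.rpow_two]
  nlinarith [mul_le_mul_of_nonneg_left hpow (sq_nonneg m)]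

/-- The noise form `E[g(x) h(x̃)]` for `x` uniform and `x̃ ← N_ρ(x)`. -/
noncomputable def noiseForm (ρ : ℝ) {n : ℕ} (g h : (Fin n → Bool) → ℝ) : ℝ :=
  ∑ x, (2 ^ n : ℝ)⁻¹ * ∑ y, noiseK ρ x y * (g x * h y)

/-- The expectation of `g` under the uniform distribution on the cube. -/
noncomputable def cubeMean {n : ℕ} (g : (Fin n → Bool) → ℝ) : ℝ :=
  ∑ x, (2 ^ n : ℝ)⁻¹ * g x

/-- The restriction of `g` to the subcube on which the first bit equals `b`. -/
def restrictHead {n : ℕ} (b : Bool) (g : (Fin (n + 1) → Bool) → ℝ) : (Fin n → Bool) → ℝ :=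
  fun x => g (Fin.cons b x)

lemma sum_cube_succ {n : ℕ} (F : (Fin (n + 1) → Bool) → ℝ) :
    ∑ x, F x = ∑ x, F (Fin.cons true x) + ∑ x, F (Fin.cons false x) := by
  rw [← (Fin.consEquiv fun _ : Fin (n + 1) => Bool).sum_comp, Fintype.sum_prod_type,
    Fintype.sum_bool]
  rfl

lemma cubeMean_succ {n : ℕ} (g : (Fin (n + 1) → Bool) → ℝ) :
    cubeMean g = (cubeMean (restrictHead true g) + cubeMean (restrictHead false g)) / 2 := by
  simp only [cubeMean, restrictHead, sum_cube_succ, ← mul_sum, pow_succ, mul_inv]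
  ring

lemma cubeMean_nonneg {n : ℕ} {g : (Fin n → Bool) → ℝ} (hg : ∀ x, 0 ≤ g x) :
    0 ≤ cubeMean g :=
  sum_nonneg fun x _ => mul_nonneg (by positivity) (hg x)

lemma noiseK_cons (ρ : ℝ) {n : ℕ} (a b : Bool) (x y : Fin n → Bool) :
    noiseK ρ (Fin.cons a x : Fin (n + 1) → Bool) (Fin.cons b y)
      = (if b = a then (1 + ρ) / 2 else (1 - ρ) / 2) * noiseK ρ x y := by
  simp [noiseK, Fin.prod_univ_succ]

lemma noiseK_comm (ρ : ℝ) {n : ℕ} (x y : Fin n → Bool) : noiseK ρ x y = noiseK ρ y x := by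
  simp only [noiseK, eq_comm]

lemma noiseForm_comm (ρ : ℝ) {n : ℕ} (g h : (Fin n → Bool) → ℝ) :
    noiseForm ρ g h = noiseForm ρ h g := by
  simp only [noiseForm, mul_sum]
  rw [sum_comm]
  refine sum_congr rfl fun x _ => sum_congr rfl fun y _ => ?_
  rw [noiseK_comm, mul_comm (g y)]

lemma noiseForm_add_left (ρ : ℝ) {n : ℕ} (g₁ g₂ h : (Fin n → Bool) → ℝ) :
    noiseForm ρ (g₁ + g₂) h = noiseForm ρ g₁ h + noiseForm ρ g₂ h := by
  simp only [noiseForm, Pi.add_apply, add_mul, mul_add, sum_add_distrib]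

lemma noiseForm_smul_left (ρ c : ℝ) {n : ℕ} (g h : (Fin n → Bool) → ℝ) :
    noiseForm ρ (c • g) h = c * noiseForm ρ g h := by
  simp only [noiseForm, Pi.smul_apply, smul_eq_mul, mul_sum]
  refine sum_congr rfl fun x _ => sum_congr rfl fun y _ => ?_
  ring

lemma noiseForm_add_smul_self (ρ t : ℝ) {n : ℕ} (g h : (Fin n → Bool) → ℝ) :
    noiseForm ρ (g + t • h) (g + t • h)
      = noiseForm ρ g g + 2 * t * noiseForm ρ g h + t ^ 2 * noiseForm ρ h h := by
  rw [noiseForm_add_left, noiseForm_smul_left, noiseForm_comm ρ g, noiseForm_comm ρ h,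
    noiseForm_add_left, noiseForm_smul_left, noiseForm_add_left, noiseForm_smul_left,
    noiseForm_comm ρ h g]
  ring

lemma noiseForm_succ (ρ : ℝ) {n : ℕ} (g : (Fin (n + 1) → Bool) → ℝ) :
    noiseForm ρ g g =
      ((1 + ρ) / 2 * (noiseForm ρ (restrictHead true g) (restrictHead true g)
          + noiseForm ρ (restrictHead false g) (restrictHead false g))
        + (1 - ρ) * noiseForm ρ (restrictHead true g) (restrictHead false g)) / 2 := by
  have h : noiseForm ρ g g =
      ((1 + ρ) / 2 * (noiseForm ρ (restrictHead true g) (restrictHead true g)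
          + noiseForm ρ (restrictHead false g) (restrictHead false g))
        + (1 - ρ) / 2 * (noiseForm ρ (restrictHead true g) (restrictHead false g)
          + noiseForm ρ (restrictHead false g) (restrictHead true g))) / 2 := by
    simp only [noiseForm, restrictHead, sum_cube_succ, noiseK_cons, ← mul_sum, pow_succ,
      mul_inv, mul_add, sum_add_distrib, mul_assoc]
    simp
    ring
  rw [h, noiseForm_comm ρ (restrictHead false g) (restrictHead true g)]
  ring

lemma noiseForm_self_nonneg {ρ : ℝ} (h0 : 0 ≤ ρ) {n : ℕ} (g : (Fin n → Bool) → ℝ) :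
    0 ≤ noiseForm ρ g g := by
  induction n with
  | zero => simpa [noiseForm, noiseK] using mul_self_nonneg _
  | succ n ih =>
    have hp := noiseForm_add_smul_self ρ 1 (restrictHead true g) (restrictHead false g)
    have hm := noiseForm_add_smul_self ρ (-1) (restrictHead true g) (restrictHead false g)
    have hp0 := ih (restrictHead true g + (1 : ℝ) • restrictHead false g)
    have hm0 := mul_nonneg h0 (ih (restrictHead true g + (-1 : ℝ) • restrictHead false g))
    rw [hp] at hp0
    rw [hm] at hm0
    rw [noiseForm_succ]
    linarith

lemma noiseForm_le_sqrt_mul_sqrt {ρ : ℝ} (h0 : 0 ≤ ρ) {n : ℕ} (g h : (Fin n → Bool) → ℝ) :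
    noiseForm ρ g h ≤ √(noiseForm ρ g g) * √(noiseForm ρ h h) := by
  have hd : discrim (noiseForm ρ h h) (2 * noiseForm ρ g h) (noiseForm ρ g g) ≤ 0 := by
    refine discrim_le_zero fun t => ?_
    have := noiseForm_self_nonneg h0 (g + t • h)
    rw [noiseForm_add_smul_self] at this
    linarith
  rw [discrim] at hd
  rw [← Real.sqrt_mul (noiseForm_self_nonneg h0 g)]
  exact Real.le_sqrt_of_sq_le (by linarith)

/-- Hypercontractivity of the noise form on the Boolean cube. -/
lemma noiseForm_self_le {ρ : ℝ} (h0 : 0 ≤ ρ) (h1 : ρ ≤ 1) {n : ℕ}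
    {g : (Fin n → Bool) → ℝ} (hg : ∀ x, 0 ≤ g x) :
    noiseForm ρ g g ≤ cubeMean (fun x => g x ^ (1 + ρ)) ^ (2 / (1 + ρ)) := by
  have hp : 0 < 1 + ρ := by linarith
  induction n with
  | zero =>
    simp only [noiseForm, noiseK, cubeMean, univ_unique, sum_singleton, univ_eq_empty,
      prod_empty, pow_zero, inv_one, one_mul]
    rw [← Real.rpow_mul (hg _), mul_div_cancel₀ _ hp.ne', Real.rpow_two, sq]
  | succ n ih =>
    have hmean (b : Bool) : 0 ≤ cubeMean (restrictHead b fun x => g x ^ (1 + ρ)) :=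
      cubeMean_nonneg fun x => Real.rpow_nonneg (hg _) _
    have hbound (b : Bool) : √(noiseForm ρ (restrictHead b g) (restrictHead b g))
        ≤ cubeMean (restrictHead b fun x => g x ^ (1 + ρ)) ^ (1 / (1 + ρ)) := by
      refine Real.sqrt_le_iff.2 ⟨Real.rpow_nonneg (hmean b) _, ?_⟩
      rw [← Real.rpow_two, ← Real.rpow_mul (hmean b), one_div_mul_eq_div]
      exact ih fun x => hg _
    have hpow (b : Bool) : (cubeMean (restrictHead b fun x => g x ^ (1 + ρ)) ^ (1 / (1 + ρ)))
        ^ (1 + ρ) = cubeMean (restrictHead b fun x => g x ^ (1 + ρ)) := by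
      rw [← Real.rpow_mul (hmean b), one_div_mul_cancel hp.ne', Real.rpow_one]
    have htwo := two_point_hypercontractive h0 h1 (Real.rpow_nonneg (hmean true) (1 / (1 + ρ)))
      (Real.rpow_nonneg (hmean false) (1 / (1 + ρ)))
    rw [hpow, hpow, ← cubeMean_succ] at htwo
    refine le_trans ?_ htwo
    have hcs := mul_le_mul_of_nonneg_left
      (noiseForm_le_sqrt_mul_sqrt h0 (restrictHead true g) (restrictHead false g))
      (sub_nonneg.2 h1)
    have hsq (b : Bool) := Real.sq_sqrt (noiseForm_self_nonneg h0 (restrictHead b g))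
    have hab := mul_le_mul_of_nonneg_left (mul_le_mul (hbound true) (hbound false)
      (Real.sqrt_nonneg _) (Real.rpow_nonneg (hmean true) _)) (sub_nonneg.2 h1)
    have hst := mul_le_mul_of_nonneg_left
      (pow_le_pow_left₀ (Real.sqrt_nonneg _) (hbound true) 2) hp.le
    have hsf := mul_le_mul_of_nonneg_left
      (pow_le_pow_left₀ (Real.sqrt_nonneg _) (hbound false) 2) hp.le
    rw [hsq] at hst hsf
    rw [noiseForm_succ]
    linarith

lemma noiseForm_indicator_le {ρ : ℝ} (h0 : 0 ≤ ρ) (h1 : ρ ≤ 1) {n : ℕ}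
    (A : Finset (Fin n → Bool)) :
    noiseForm ρ (fun x => if x ∈ A then 1 else 0) (fun x => if x ∈ A then 1 else 0)
      ≤ ((A.card : ℝ) / 2 ^ n) ^ (2 / (1 + ρ)) := by
  refine (noiseForm_self_le h0 h1 fun x => by split_ifs <;> norm_num).trans_eq ?_
  have hp : 1 + ρ ≠ 0 := by linarith
  simp only [cubeMean, ite_pow, Real.one_rpow, Real.zero_rpow hp, ← mul_sum]
  congr 1
  simp [div_eq_inv_mul]


/-- Let `α > 0`, let `Y` be a set, and let `f : {0,1}^n → Y` be a
deterministic function such that every fiber of `f` has density at most `α`, i.e.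
`|f⁻¹(y)|/2ⁿ ≤ α` for all `y ∈ Y`.  Then for every `ρ ∈ [0,1]`,
`Pr[f(x̃) = f(x)] ≤ α^{(1/2)·(1−ρ²)/(1+ρ²)}`, where `x` is uniform on `{0,1}^n`
and `x̃ ← N_ρ(x)`. -/
theorem deterministic_collision_bound {n : ℕ} {Y : Type*} [DecidableEq Y]
    (α : ℝ) (hα : 0 < α)
    (f : (Fin n → Bool) → Y)
    (hfiber : ∀ y : Y,
      ((Finset.univ.filter fun x : Fin n → Bool => f x = y).card : ℝ) / 2 ^ n ≤ α)
    (ρ : ℝ) (hρ : ρ ∈ Set.Icc (0 : ℝ) 1) :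
    ∑ x, (2 ^ n : ℝ)⁻¹ * ∑ xt, noiseK ρ x xt * (if f xt = f x then 1 else 0)
      ≤ α ^ ((1 / 2) * ((1 - ρ ^ 2) / (1 + ρ ^ 2))) := by
  obtain ⟨h0, h1⟩ := hρ
  have hp : 0 < 1 + ρ := by linarith
  set β := min α 1
  have hβ : 0 < β := lt_min hα one_pos
  set μ : Y → ℝ := fun y => ((univ.filter fun x : Fin n → Bool => f x = y).card : ℝ) / 2 ^ n
    with hμ
  have hμ0 (y : Y) : 0 ≤ μ y := by positivity
  have hμβ (y : Y) : μ y ≤ β := by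
    refine le_min (hfiber y) ((div_le_one (by positivity)).2 ?_)
    have := card_le_univ (univ.filter fun x : Fin n → Bool => f x = y)
    rw [Fintype.card_fun, Fintype.card_bool, Fintype.card_fin] at this
    exact_mod_cast this
  have hsum : ∑ y ∈ univ.image f, μ y = 1 := by
    have := card_eq_sum_card_image f (univ : Finset (Fin n → Bool))
    rw [card_univ, Fintype.card_fun, Fintype.card_bool, Fintype.card_fin] at this
    rw [hμ, ← sum_div, div_eq_one_iff_eq (by positivity)]
    exact_mod_cast this.symm
  have hdecomp : ∑ x, (2 ^ n : ℝ)⁻¹ * ∑ xt, noiseK ρ x xt * (if f xt = f x then 1 else 0)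
      = ∑ y ∈ univ.image f, noiseForm ρ
        (fun x => if x ∈ univ.filter (fun x => f x = y) then 1 else 0)
        (fun x => if x ∈ univ.filter (fun x => f x = y) then 1 else 0) := by
    simp only [noiseForm]
    rw [sum_comm]
    refine sum_congr rfl fun x _ => ?_
    rw [← mul_sum, sum_comm]
    congr 1
    refine sum_congr rfl fun z _ => ?_
    rw [← mul_sum]
    congr 1
    rw [sum_eq_single (f x)]
    · simp
    · intro y _ hy
      simp [hy.symm]
    · simp
  have hterm (y : Y) : μ y ^ (2 / (1 + ρ)) ≤ μ y * β ^ ((1 - ρ) / (1 + ρ)) := by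
    have he : 2 / (1 + ρ) = 1 + (1 - ρ) / (1 + ρ) := by field_simp; ring
    have he0 : 0 ≤ (1 - ρ) / (1 + ρ) := div_nonneg (by linarith) hp.le
    rw [he, Real.rpow_add_of_nonneg (hμ0 y) zero_le_one he0, Real.rpow_one]
    exact mul_le_mul_of_nonneg_left (Real.rpow_le_rpow (hμ0 y) (hμβ y) he0) (hμ0 y)
  have hexp : (1 / 2) * ((1 - ρ ^ 2) / (1 + ρ ^ 2)) ≤ (1 - ρ) / (1 + ρ) := by
    rw [← mul_div_mul_comm, div_le_div_iff₀ (by positivity) hp]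
    nlinarith [mul_nonneg (sub_nonneg.2 h1) (sq_nonneg (1 - ρ))]
  have hexp0 : 0 ≤ (1 / 2) * ((1 - ρ ^ 2) / (1 + ρ ^ 2)) :=
    mul_nonneg (by norm_num) (div_nonneg (by nlinarith) (by positivity))
  calc _ ≤ ∑ y ∈ univ.image f, μ y ^ (2 / (1 + ρ)) :=
        hdecomp.trans_le (sum_le_sum fun y _ => noiseForm_indicator_le h0 h1 _)
    _ ≤ ∑ y ∈ univ.image f, μ y * β ^ ((1 - ρ) / (1 + ρ)) := sum_le_sum fun y _ => hterm y
    _ = β ^ ((1 - ρ) / (1 + ρ)) := by rw [← sum_mul, hsum, one_mul]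
    _ ≤ β ^ ((1 / 2) * ((1 - ρ ^ 2) / (1 + ρ ^ 2))) :=
        Real.rpow_le_rpow_of_exponent_ge hβ (min_le_right _ _) hexp
    _ ≤ α ^ ((1 / 2) * ((1 - ρ ^ 2) / (1 + ρ ^ 2))) :=
        Real.rpow_le_rpow hβ.le (min_le_left _ _) hexp0
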